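/- Let C be a chain complex of finite-dimensional vector spaces over ℚ and let φ : C → C be a morphism of chain complexes such that for every n the component φ_n : C_n → C_n is diagonalizable. Then for every n the endomorphism induced by φ on the n-th homology group H_n(C) is diagonalizable, and its eigenvalues are among the eigenvalues of φ_n. -/

import Mathlib

/-- A linear endomorphism is diagonalizable if the supremum of its eigenspaces
is the whole space. -/
def IsDiagonalizable {k V : Type*} [Field k] [AddCommGroup V] [Module k V]
    (f : V →ₗ[k] V) : Prop :=
  (⨆ μ : k, Module.End.eigenspace f μ) = ⊤

namespace IsDiagonalizable

variable {k V W : Type*} [Field k] [AddCommGroup V] [Module k V] [AddCommGroup W] [Module k W]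
  {f : V →ₗ[k] V} {g : W →ₗ[k] W}

theorem map_eigenspace_le (i : V →ₗ[k] W) (h : ∀ x, i (f x) = g (i x)) (μ : k) :
    (Module.End.eigenspace f μ).map i ≤ Module.End.eigenspace g μ := by
  rintro _ ⟨x, hx, rfl⟩
  rw [SetLike.mem_coe, Module.End.mem_eigenspace_iff] at hx
  rw [Module.End.mem_eigenspace_iff, ← h, hx, map_smul]

theorem of_injective [FiniteDimensional k W] (hg : IsDiagonalizable g) (i : V →ₗ[k] W)
    (hi : Function.Injective i) (h : ∀ x, i (f x) = g (i x)) : IsDiagonalizable f := by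
  have hinv : ∀ x ∈ LinearMap.range i, g x ∈ LinearMap.range i := by
    rintro _ ⟨x, rfl⟩
    exact ⟨f x, h x⟩
  have hsup : LinearMap.range i = ⨆ μ, LinearMap.range i ⊓ Module.End.eigenspace g μ := by
    have := Submodule.inf_iSup_genEigenspace (f := g) hinv 1
    rwa [show (⨆ μ, Module.End.genEigenspace g μ 1) = ⊤ from hg, inf_top_eq] at this
  apply Submodule.map_injective_of_injective hi
  refine le_antisymm (Submodule.map_mono le_top) ?_
  rw [Submodule.map_top, Submodule.map_iSup]
  refine hsup.le.trans (iSup_mono fun μ => ?_)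
  rintro _ ⟨⟨x, rfl⟩, hx⟩
  refine ⟨x, ?_, rfl⟩
  rw [SetLike.mem_coe, Module.End.mem_eigenspace_iff] at hx ⊢
  exact hi (by rw [h, hx, map_smul])

theorem of_surjective (hf : IsDiagonalizable f) (p : V →ₗ[k] W)
    (hp : Function.Surjective p) (h : ∀ x, p (f x) = g (p x)) : IsDiagonalizable g := by
  rw [IsDiagonalizable, eq_top_iff, ← LinearMap.range_eq_top.mpr hp, ← Submodule.map_top,
    ← show (⨆ μ, Module.End.eigenspace f μ) = ⊤ from hf, Submodule.map_iSup]
  exact iSup_mono (map_eigenspace_le p h)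

theorem hasEigenvalue_of_surjective (hf : IsDiagonalizable f) (p : V →ₗ[k] W)
    (hp : Function.Surjective p) (h : ∀ x, p (f x) = g (p x)) {μ : k}
    (hμ : Module.End.HasEigenvalue g μ) : Module.End.HasEigenvalue f μ := by
  rw [Module.End.hasEigenvalue_iff] at hμ ⊢
  contrapose! hμ
  have htop : (⨆ ν, ⨆ (_ : ν ≠ μ), Module.End.eigenspace g ν) = ⊤ := by
    rw [eq_top_iff, ← LinearMap.range_eq_top.mpr hp, ← Submodule.map_top,
      ← show (⨆ ν, Module.End.eigenspace f ν) = ⊤ from hf, Submodule.map_iSup]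
    refine iSup_le fun ν => ?_
    rcases eq_or_ne ν μ with rfl | hν
    · simp [hμ]
    · exact (map_eigenspace_le p h ν).trans
        (le_iSup₂_of_le (f := fun ν (_ : ν ≠ μ) => Module.End.eigenspace g ν) ν hν le_rfl)
  have hdisj := Module.End.eigenspaces_iSupIndep g μ
  rwa [htop, disjoint_top] at hdisj

end IsDiagonalizable

theorem Module.End.HasEigenvalue.of_injective {k V W : Type*} [Field k] [AddCommGroup V]
    [Module k V] [AddCommGroup W] [Module k W] {f : V →ₗ[k] V} {g : W →ₗ[k] W} (i : V →ₗ[k] W)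
    (hi : Function.Injective i) (h : ∀ x, i (f x) = g (i x)) {μ : k}
    (hμ : Module.End.HasEigenvalue f μ) : Module.End.HasEigenvalue g μ := by
  rw [Module.End.hasEigenvalue_iff] at hμ ⊢
  contrapose! hμ
  have := IsDiagonalizable.map_eigenspace_le i h μ
  rw [hμ, le_bot_iff] at this
  exact Submodule.map_injective_of_injective hi (by rw [this, Submodule.map_bot])

/-- If a morphism of chain complexes of finite-dimensional `ℚ`-vector spaces is
diagonalizable in each degree, then the induced endomorphism on each homology group is
diagonalizable, with eigenvalues among those of the corresponding component. -/
theorem homology_map_diagonalizable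
    (C : ChainComplex (ModuleCat ℚ) ℕ) [∀ n, FiniteDimensional ℚ (C.X n)]
    (φ : C ⟶ C)
    (hφ : ∀ n, IsDiagonalizable ((φ.f n).hom : C.X n →ₗ[ℚ] C.X n)) (n : ℕ) :
    IsDiagonalizable
      ((HomologicalComplex.homologyMap φ n).hom : C.homology n →ₗ[ℚ] C.homology n) ∧
    ∀ μ : ℚ, Module.End.HasEigenvalue
        ((HomologicalComplex.homologyMap φ n).hom : C.homology n →ₗ[ℚ] C.homology n) μ →
      Module.End.HasEigenvalue ((φ.f n).hom : C.X n →ₗ[ℚ] C.X n) μ := by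
  have hi : Function.Injective (C.iCycles n).hom :=
    (ModuleCat.mono_iff_injective _).mp inferInstance
  have hp : Function.Surjective (C.homologyπ n).hom :=
    (ModuleCat.epi_iff_surjective _).mp inferInstance
  have hi_comm (x : C.cycles n) : (C.iCycles n).hom
      ((HomologicalComplex.cyclesMap φ n).hom x) = (φ.f n).hom ((C.iCycles n).hom x) :=
    LinearMap.congr_fun (congrArg ModuleCat.Hom.hom (HomologicalComplex.cyclesMap_i φ n)) x
  have hp_comm (x : C.cycles n) : (C.homologyπ n).hom
      ((HomologicalComplex.cyclesMap φ n).hom x) =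
        (HomologicalComplex.homologyMap φ n).hom ((C.homologyπ n).hom x) :=
    (LinearMap.congr_fun
      (congrArg ModuleCat.Hom.hom (HomologicalComplex.homologyπ_naturality φ n)) x).symm
  have hcycles := (hφ n).of_injective _ hi hi_comm
  exact ⟨hcycles.of_surjective _ hp hp_comm, fun μ hμ =>
    (hcycles.hasEigenvalue_of_surjective _ hp hp_comm hμ).of_injective _ hi hi_comm⟩
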